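/- arXiv:math/0110135 — 2 statements merged into one kernel-verified Lean document; each statement's English description precedes it below -/
import Mathlib

section
/- Let k be a field of characteristic zero, complete with respect to a nontrivial non-Archimedean absolute value, let n,l ≥ 1, and let r > 0, M > 0. Let Λ : k^n → k^n be additive and non-expanding, i.e. ‖Λx‖ ≤ ‖x‖ for all x ∈ k^n, and let G be a function from the closed ball {x ∈ k^n : ‖x‖ ≤ r} to the n×l matrices over k satisfying ‖G(x)‖ ≤ M for all such x and ‖G(x) − G(y)‖ ≤ (M/r)‖x − y‖ for all x,y in the closed ball. Then for every u ∈ k^l with ‖u‖ < r/M and every w ∈ k^n with ‖w‖ < r there exists a unique h ∈ k^n with ‖h‖ ≤ r such that h = Λ(w + G(h)·u), where (G(h)·u)_i = Σ_{j=1}^l G(h)_{ij} u_j; moreover this h satisfies ‖h‖ < r. -/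
/-- Over an ultrametric field, the product of a matrix and a vector satisfies
`‖A u‖ ≤ ‖A‖ ‖u‖` for the sup norms. -/
lemma norm_sum_mul_le_of_ultrametric {k ι κ : Type*} [NormedField k] [IsUltrametricDist k]
    [Fintype ι] [Fintype κ] (A : ι → κ → k) (u : κ → k) :
    ‖fun i => ∑ j, A i j * u j‖ ≤ ‖A‖ * ‖u‖ := by
  refine (pi_norm_le_iff_of_nonneg (by positivity)).2 fun i => ?_
  refine IsUltrametricDist.norm_sum_le_of_forall_le_of_nonneg (by positivity) fun j _ => ?_
  rw [norm_mul]
  gcongr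
  · exact (norm_le_pi_norm (A i) j).trans (norm_le_pi_norm A i)
  · exact norm_le_pi_norm u j

/-- **Non-analytic Lagrange inversion, fixed point version.**
Let `k` be a field of characteristic zero, complete with respect to a nontrivial
non-Archimedean absolute value, `n, l ≥ 1`, `r > 0`, `M > 0`.  Let `Λ : kⁿ → kⁿ` be
additive and non-expanding, and let `G` map the closed ball of radius `r` of `kⁿ`
to `n × l` matrices over `k` (with the sup norm of the entries) with `‖G x‖ ≤ M`
and `‖G x - G y‖ ≤ (M/r) ‖x - y‖` on that ball.  Then for every `u` with `‖u‖ < r/M`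
and `w` with `‖w‖ < r` there is a unique `h` with `‖h‖ ≤ r` satisfying
`h = Λ (w + G(h)·u)`, and moreover `‖h‖ < r`. -/
theorem stmt_0
    {k : Type*} [NontriviallyNormedField k] [CompleteSpace k] [CharZero k]
    (hultra : IsUltrametricDist k)
    {n l : ℕ} (hn : 1 ≤ n) (hl : 1 ≤ l)
    (r M : ℝ) (hr : 0 < r) (hM : 0 < M)
    (Λ : (Fin n → k) → (Fin n → k))
    (hΛadd : ∀ x y : Fin n → k, Λ (x + y) = Λ x + Λ y)
    (hΛne : ∀ x : Fin n → k, ‖Λ x‖ ≤ ‖x‖)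
    (G : (Fin n → k) → (Fin n → Fin l → k))
    (hGbd : ∀ x : Fin n → k, ‖x‖ ≤ r → ‖G x‖ ≤ M)
    (hGlip : ∀ x y : Fin n → k, ‖x‖ ≤ r → ‖y‖ ≤ r →
      ‖G x - G y‖ ≤ (M / r) * ‖x - y‖)
    (u : Fin l → k) (hu : ‖u‖ < r / M)
    (w : Fin n → k) (hw : ‖w‖ < r) :
    ∃ h : Fin n → k,
      (‖h‖ ≤ r ∧ h = Λ (w + fun i => ∑ j, G h i j * u j)) ∧
      ‖h‖ < r ∧
      ∀ h' : Fin n → k, ‖h'‖ ≤ r →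
        h' = Λ (w + fun i => ∑ j, G h' i j * u j) → h' = h := by
  have hΛsub (x y : Fin n → k) : Λ x - Λ y = Λ (x - y) := by
    rw [sub_eq_iff_eq_add, ← hΛadd, sub_add_cancel]
  set F : (Fin n → k) → (Fin n → k) := fun h => Λ (w + fun i => ∑ j, G h i j * u j) with hF
  have hMu : M * ‖u‖ < r := by
    rw [mul_comm]
    exact (lt_div_iff₀ hM).1 hu
  have hFlt (h : Fin n → k) (hh : ‖h‖ ≤ r) : ‖F h‖ < r := by
    refine (hΛne _).trans_lt ((IsUltrametricDist.norm_add_le_max _ _).trans_lt (max_lt hw ?_))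
    refine (norm_sum_mul_le_of_ultrametric _ _).trans_lt (lt_of_le_of_lt ?_ hMu)
    gcongr
    exact hGbd h hh
  obtain ⟨c, hc⟩ : ∃ c : NNReal, (c : ℝ) = M / r * ‖u‖ :=
    ⟨_, Real.coe_toNNReal _ (by positivity)⟩
  have hc1 : c < 1 := by
    rw [← NNReal.coe_lt_coe, hc, NNReal.coe_one, div_mul_eq_mul_div]
    exact (div_lt_one hr).2 hMu
  have hFlip (x y : Fin n → k) (hx : ‖x‖ ≤ r) (hy : ‖y‖ ≤ r) :
      ‖F x - F y‖ ≤ c * ‖x - y‖ := by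
    have hdiff : (w + fun i => ∑ j, G x i j * u j) - (w + fun i => ∑ j, G y i j * u j) =
        fun i => ∑ j, (G x - G y) i j * u j := by
      ext i
      simp [sub_mul]
    calc ‖F x - F y‖ ≤ ‖fun i => ∑ j, (G x - G y) i j * u j‖ := by
          rw [hF, hΛsub, hdiff]
          exact hΛne _
      _ ≤ ‖G x - G y‖ * ‖u‖ := norm_sum_mul_le_of_ultrametric _ _
      _ ≤ M / r * ‖x - y‖ * ‖u‖ := by
          gcongr
          exact hGlip x y hx hy
      _ = c * ‖x - y‖ := by
          rw [hc]
          ring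
  have hmaps : Set.MapsTo F (Metric.closedBall 0 r) (Metric.closedBall 0 r) := fun x hx =>
    mem_closedBall_zero_iff.2 (hFlt x (mem_closedBall_zero_iff.1 hx)).le
  have hcontr : ContractingWith c hmaps.restrict := by
    refine ⟨hc1, LipschitzWith.of_dist_le_mul fun x y => ?_⟩
    rw [Subtype.dist_eq, Subtype.dist_eq, dist_eq_norm, dist_eq_norm]
    exact hFlip x y (mem_closedBall_zero_iff.1 x.2) (mem_closedBall_zero_iff.1 y.2)
  obtain ⟨h, hh, hfix, -⟩ := hcontr.exists_fixedPoint' Metric.isClosed_closedBall.isComplete hmaps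
    (Metric.mem_closedBall_self hr.le) (edist_ne_top _ _)
  have hhr : ‖h‖ ≤ r := mem_closedBall_zero_iff.1 hh
  refine ⟨h, ⟨hhr, hfix.eq.symm⟩, ?_, fun h' hh' hfix' => ?_⟩
  · rw [← hfix.eq]
    exact hFlt h hhr
  · have hle : ‖h' - h‖ ≤ c * ‖h' - h‖ := by
      have := hFlip h' h hh' hhr
      rwa [hfix.eq, ← show h' = F h' from hfix'] at this
    have hc1' : (c : ℝ) < 1 := NNReal.coe_lt_one.2 hc1
    rw [← sub_eq_zero, ← norm_le_zero_iff]
    nlinarith [norm_nonneg (h' - h)]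
end

section
/- Let k be a field of characteristic zero, complete with respect to a nontrivial non-Archimedean absolute value, let n ≥ 1 and r > 0, and let (F_α)_{α∈ℕ^n} be a family of elements of k such that for every r′ with 0 < r′ < r one has sup_{α} |F_α| r′^{|α|} < +∞ (so that for every x ∈ k^n with ‖x‖ < r the family (F_α x^α)_α tends to 0 and the sum Σ_{α∈ℕ^n} F_α x^α converges). If Σ_{α∈ℕ^n} F_α x^α = 0 for every x ∈ k^n with ‖x‖ < r, then F_α = 0 for every α ∈ ℕ^n. -/
/-- A power series in one variable whose sum vanishes near the origin has zero coefficients. -/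
theorem coeff_eq_zero_of_hasSum_zero {k : Type*} [NontriviallyNormedField k] {ρ : ℝ}
    (hρ : 0 < ρ) (a : ℕ → k) (h : ∀ t : k, ‖t‖ < ρ → HasSum (fun m => a m * t ^ m) 0) (m : ℕ) :
    a m = 0 := by
  have hp : HasFPowerSeriesAt (0 : k → k) (FormalMultilinearSeries.ofScalars k a) 0 := by
    rw [hasFPowerSeriesAt_iff]
    filter_upwards [Metric.ball_mem_nhds (0 : k) hρ] with z hz
    simpa [FormalMultilinearSeries.coeff_ofScalars, mul_comm] using
      h z (by simpa using hz)
  rw [← FormalMultilinearSeries.coeff_ofScalars (𝕜 := k) (p := a) (n := m), hp.eq_zero]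
  rfl

/-- The multivariate geometric series converges. -/
theorem summable_prod_geometric {q : ℝ} (hq0 : 0 ≤ q) (hq1 : q < 1) (n : ℕ) :
    Summable fun α : Fin n → ℕ => ∏ i, q ^ α i := by
  induction n with
  | zero => exact Summable.of_finite
  | succ n ih =>
    rw [← (Fin.consEquiv fun _ : Fin (n + 1) => ℕ).summable_iff]
    refine ((summable_geometric_of_lt_one hq0 hq1).mul_of_nonneg ih (fun _ => by positivity)
      (fun _ => by positivity)).congr fun p => ?_
    simp [Fin.consEquiv, Fin.prod_univ_succ]

/-- A power series with coefficients satisfying a Cauchy estimate of radius `ρ` is summable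
on the open polydisc of radius `ρ`. -/
theorem summable_powerSeries_of_bound {k : Type*} [NormedField k] [CompleteSpace k] {n : ℕ}
    {ρ C : ℝ} (hρ : 0 < ρ) (F : (Fin n → ℕ) → k) (hF : ∀ α, ‖F α‖ * ρ ^ (∑ i, α i) ≤ C)
    (x : Fin n → k) (hx : ‖x‖ < ρ) : Summable fun α => F α * ∏ i, x i ^ α i := by
  refine Summable.of_norm_bounded ((summable_prod_geometric (q := ‖x‖ / ρ) (by positivity)
    ((div_lt_one hρ).2 hx) n).mul_left C) fun α => ?_
  rw [Finset.prod_pow_eq_pow_sum, norm_mul, norm_prod, div_pow]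
  have h : ∏ i, ‖x i ^ α i‖ ≤ ‖x‖ ^ (∑ i, α i) := by
    rw [← Finset.prod_pow_eq_pow_sum]
    refine Finset.prod_le_prod (fun _ _ => norm_nonneg _) fun i _ => ?_
    rw [norm_pow]
    gcongr
    exact norm_le_pi_norm x i
  calc ‖F α‖ * ∏ i, ‖x i ^ α i‖ ≤ ‖F α‖ * ‖x‖ ^ (∑ i, α i) := by gcongr
    _ = ‖F α‖ * ρ ^ (∑ i, α i) * (‖x‖ ^ (∑ i, α i) / ρ ^ (∑ i, α i)) := by
      field_simp
    _ ≤ _ := by gcongr; exact hF α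

/-- Identity theorem for multivariate power series over a complete field. -/
theorem coeff_eq_zero_of_tsum_eq_zero {k : Type*} [NontriviallyNormedField k] [CompleteSpace k]
    {n : ℕ} {ρ : ℝ} (hρ : 0 < ρ) (C : ℝ) (F : (Fin n → ℕ) → k)
    (hF : ∀ α, ‖F α‖ * ρ ^ (∑ i, α i) ≤ C)
    (hzero : ∀ x : Fin n → k, ‖x‖ < ρ → ∑' α : Fin n → ℕ, F α * ∏ i, x i ^ α i = 0)
    (α : Fin n → ℕ) : F α = 0 := by
  induction n generalizing C with
  | zero =>
    have h := hzero 0 (norm_zero.trans_lt hρ)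
    rw [tsum_eq_single α fun b hb => absurd (Subsingleton.elim b α) hb] at h
    simpa using h
  | succ n ih =>
    have hslice : ∀ m (β : Fin n → ℕ),
        ‖F (Fin.cons m β)‖ * ρ ^ (∑ i, β i) ≤ C / ρ ^ m := fun m β => by
      rw [le_div_iff₀ (by positivity)]
      refine le_of_eq_of_le ?_ (hF (Fin.cons m β))
      rw [Fin.sum_univ_succ, pow_add]
      simp only [Fin.cons_zero, Fin.cons_succ]
      ring
    rw [← Fin.cons_self_tail α]
    refine ih (C / ρ ^ α 0) (fun β => F (Fin.cons (α 0) β)) (hslice _) (fun y hy => ?_) _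
    refine coeff_eq_zero_of_hasSum_zero hρ
      (fun m => ∑' β : Fin n → ℕ, F (Fin.cons m β) * ∏ i, y i ^ β i) (fun t ht => ?_) (α 0)
    have hx : ‖(Fin.cons t y : Fin (n + 1) → k)‖ < ρ := by
      rw [pi_norm_lt_iff hρ]
      refine Fin.cases (by simpa using ht) fun i => ?_
      simpa using (norm_le_pi_norm y i).trans_lt hy
    have hsum := (summable_powerSeries_of_bound hρ F hF _ hx).hasSum
    rw [hzero _ hx, ← (Fin.consEquiv fun _ : Fin (n + 1) => ℕ).hasSum_iff] at hsum
    refine hsum.prod_fiberwise fun m => ?_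
    have hy' := (summable_powerSeries_of_bound hρ _ (hslice m) y hy).hasSum.mul_right (t ^ m)
    have hterm : (fun β : Fin n → ℕ => F (Fin.cons m β) * (∏ i, y i ^ β i) * t ^ m) =
        fun β => ((fun α => F α * ∏ i, (Fin.cons t y : Fin (n + 1) → k) i ^ α i) ∘
          Fin.consEquiv fun _ : Fin (n + 1) => ℕ) (m, β) := by
      ext β
      change _ = F (Fin.cons m β) * ∏ i, (Fin.cons t y : Fin (n + 1) → k) i ^
        (Fin.cons m β : Fin (n + 1) → ℕ) i
      simp only [Fin.prod_univ_succ, Fin.cons_zero, Fin.cons_succ]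
      ring
    rwa [hterm] at hy'

/-- **Identity theorem for power series over a non-Archimedean field.**
Let `k` be a field of characteristic zero, complete with respect to a nontrivial
non-Archimedean absolute value, `n ≥ 1`, `r > 0`, and `(F_α)_{α ∈ ℕⁿ}` a family of
elements of `k` with `sup_α ‖F_α‖ r'^{|α|} < ∞` for every `0 < r' < r`.  If
`∑_α F_α x^α = 0` for every `x ∈ kⁿ` with `‖x‖ < r`, then `F_α = 0` for all `α`. -/
theorem stmt_17
    {k : Type*} [NontriviallyNormedField k] [CompleteSpace k] [CharZero k]
    (hultra : IsUltrametricDist k)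
    {n : ℕ} (hn : 1 ≤ n) (r : ℝ) (hr : 0 < r)
    (F : (Fin n → ℕ) → k)
    (hF : ∀ r' : ℝ, 0 < r' → r' < r → ∃ C : ℝ, ∀ α : Fin n → ℕ,
      ‖F α‖ * r' ^ (∑ i, α i) ≤ C)
    (hzero : ∀ x : Fin n → k, ‖x‖ < r →
      (∑' α : Fin n → ℕ, F α * ∏ i, x i ^ α i) = 0) :
    ∀ α : Fin n → ℕ, F α = 0 := by
  obtain ⟨C, hC⟩ := hF (r / 2) (by linarith) (by linarith)
  exact coeff_eq_zero_of_tsum_eq_zero (half_pos hr) C F hC fun x hx => hzero x (by linarith)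
end
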